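/- Let Ω ⊆ ℝ³ be a bounded convex open set, −3 < γ ≤ 1, B₀ > 0, and let ν be the collision frequency. Let k_α : ℝ³ × ℝ³ → ℝ be a measurable kernel for which there exist constants C₀ > 0 and α₁, α₂, α₃ > 0 such that for all v ≠ v_*, both |k_α(v, v_*)| ≤ C₀ w_γ(|v − v_*|) (1 + |v| + |v_*|)^{γ−1} e^{−α₁ |v − v_*|²} e^{−α₃ ((v − v_*)·v/|v − v_*| − α₂ |v − v_*|)²} and |k_α(v, v_*)| ≤ C₀ w_γ(|v − v_*|) (1 + |v| + |v_*|)^{γ−1} e^{−α₁ |v − v_*|²} e^{−α₃ ((v − v_*)·v_*/|v − v_*| + α₂ |v − v_*|)²} hold. Then there exists a constant C > 0 such that for every measurable h : Ω × ℝ³ → ℝ, ∫_Ω ∫_{ℝ³} (∫₀^{τ₋(x,v)} e^{−ν(v) t} ∫_{ℝ³} |k_α(v, v_*)| |h(x − t v, v_*)| dv_* dt)² (1 + |v|)^γ dv dx ≤ C ∫_Ω ∫_{ℝ³} h(x, v)² (1 + |v|)^γ dv dx. -/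

import Mathlib

open MeasureTheory Real Set
open scoped ENNReal RealInnerProductSpace

noncomputable section

/-- `ℝ³` as a Euclidean space. -/
abbrev E3 : Type := EuclideanSpace ℝ (Fin 3)

/-- The collision frequency `ν(v) = B₀ π ∫_{ℝ³} |v − w|^γ e^{−|w|²} dw`. -/
def nu (B₀ γ : ℝ) (v : E3) : ℝ :=
  B₀ * π * ∫ w : E3, ‖v - w‖ ^ γ * Real.exp (-‖w‖ ^ 2)

/-- The backward exit time `τ₋(x, v) = inf {t > 0 : x − t v ∉ Ω}` (equal to `+∞` if
no such `t` exists). -/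
def tauMinus (Ω : Set E3) (x v : E3) : ℝ≥0∞ :=
  sInf (ENNReal.ofReal '' {t : ℝ | 0 < t ∧ x - t • v ∉ Ω})

/-- The interval of integration `(0, τ₋(x,v))`. -/
def tauItv (Ω : Set E3) (x v : E3) : Set ℝ :=
  {t : ℝ | 0 < t ∧ ENNReal.ofReal t < tauMinus Ω x v}

/-- The singular weight `w_γ`. -/
def wGamma (γ r : ℝ) : ℝ :=
  if -1 < γ then 1 / r
  else if γ = -1 then (|Real.log r| + 1) / r
  else 1 / r ^ |γ|

/-- Cauchy–Schwarz with respect to a weight `w`. -/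
theorem sq_lintegral_mul_le {α : Type*} [MeasurableSpace α] (μ : Measure α) {w g : α → ℝ≥0∞}
    (hw : Measurable w) (hg : Measurable g) :
    (∫⁻ a, w a * g a ∂μ) ^ 2 ≤ (∫⁻ a, w a ∂μ) * ∫⁻ a, w a * g a ^ 2 ∂μ := by
  have hsq : ∀ z : ℝ≥0∞, (z ^ (1 / 2 : ℝ)) ^ 2 = z := fun z => by
    rw [← ENNReal.rpow_natCast, ← ENNReal.rpow_mul]; norm_num
  have hmul : ∀ z : ℝ≥0∞, z ^ (1 / 2 : ℝ) * z ^ (1 / 2 : ℝ) = z := fun z => by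
    rw [← sq, hsq]
  have hs : Measurable fun a => w a ^ (1 / 2 : ℝ) := hw.pow_const _
  have key := ENNReal.lintegral_mul_le_Lp_mul_Lq μ Real.HolderConjugate.two_two
    hs.aemeasurable (hs.mul hg).aemeasurable
  simp only [Pi.mul_apply, ← mul_assoc, hmul, ENNReal.rpow_two, mul_pow, hsq] at key
  calc (∫⁻ a, w a * g a ∂μ) ^ 2
      ≤ ((∫⁻ a, w a ∂μ) ^ (1 / 2 : ℝ) * (∫⁻ a, w a * g a ^ 2 ∂μ) ^ (1 / 2 : ℝ)) ^ 2 := by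
        gcongr
    _ = _ := by rw [mul_pow, hsq, hsq]

/-- A weighted Schur test for a kernel dominated by a convolution kernel. -/
theorem lintegral_sq_kernel_le {κ : E3 → E3 → ℝ≥0∞} {φ W f : E3 → ℝ≥0∞}
    (hκ : Measurable (Function.uncurry κ)) (hφ : Measurable φ) (hW : Measurable W)
    (hf : Measurable f) (hW0 : ∀ v, W v ≠ 0) (hWt : ∀ v, W v ≠ ∞)
    (h₁ : ∀ v u, v ≠ u → κ v u ≤ φ (v - u) * W v)
    (h₂ : ∀ v u, v ≠ u → κ v u ≤ φ (v - u) * W u) :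
    ∫⁻ v, (∫⁻ u, κ v u * f u) ^ 2 * (W v)⁻¹ ≤ (∫⁻ z, φ z) ^ 2 * ∫⁻ u, f u ^ 2 * W u := by
  have hne : ∀ v : E3, ∀ᵐ u : E3, v ≠ u := fun v => by
    filter_upwards [compl_mem_ae_iff.2 (measure_singleton v)] with u hu using fun h => hu h.symm
  have hpt : ∀ v, (∫⁻ u, κ v u * f u) ^ 2 * (W v)⁻¹ ≤
      (∫⁻ z, φ z) * ∫⁻ u, φ (v - u) * (f u ^ 2 * W u) := fun v => by
    have hA : ∫⁻ u, κ v u ≤ (∫⁻ z, φ z) * W v := by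
      calc ∫⁻ u, κ v u ≤ ∫⁻ u, φ (v - u) * W v :=
            lintegral_mono_ae ((hne v).mono fun u hu => h₁ v u hu)
        _ = (∫⁻ z, φ z) * W v := by
            rw [lintegral_mul_const _ (by fun_prop),
              lintegral_sub_left_eq_self φ v]
    have hB : ∫⁻ u, κ v u * f u ^ 2 ≤ ∫⁻ u, φ (v - u) * (f u ^ 2 * W u) :=
      lintegral_mono_ae ((hne v).mono fun u hu => by
        calc κ v u * f u ^ 2 ≤ φ (v - u) * W u * f u ^ 2 := by gcongr; exact h₂ v u hu
          _ = _ := by ring)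
    calc (∫⁻ u, κ v u * f u) ^ 2 * (W v)⁻¹
        ≤ ((∫⁻ u, κ v u) * ∫⁻ u, κ v u * f u ^ 2) * (W v)⁻¹ := by
          gcongr
          exact sq_lintegral_mul_le _ (hκ.comp measurable_prodMk_left) hf
      _ ≤ (((∫⁻ z, φ z) * W v) * ∫⁻ u, φ (v - u) * (f u ^ 2 * W u)) * (W v)⁻¹ := by
          gcongr
      _ = (∫⁻ z, φ z) * (∫⁻ u, φ (v - u) * (f u ^ 2 * W u)) * (W v * (W v)⁻¹) := by ring
      _ = _ := by rw [ENNReal.mul_inv_cancel (hW0 v) (hWt v), mul_one]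
  have hsub : Measurable fun p : E3 × E3 => φ (p.1 - p.2) :=
    hφ.comp (measurable_fst.sub measurable_snd)
  have hfW : Measurable fun u => f u ^ 2 * W u := (hf.pow_const 2).mul hW
  have hintg : Measurable fun p : E3 × E3 => φ (p.1 - p.2) * (f p.2 ^ 2 * W p.2) :=
    hsub.mul (hfW.comp measurable_snd)
  calc ∫⁻ v, (∫⁻ u, κ v u * f u) ^ 2 * (W v)⁻¹
      ≤ ∫⁻ v, (∫⁻ z, φ z) * ∫⁻ u, φ (v - u) * (f u ^ 2 * W u) := lintegral_mono hpt
    _ = (∫⁻ z, φ z) * ∫⁻ v, ∫⁻ u, φ (v - u) * (f u ^ 2 * W u) :=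
        lintegral_const_mul _ hintg.lintegral_prod_right'
    _ = (∫⁻ z, φ z) * ∫⁻ u, ∫⁻ v, φ (v - u) * (f u ^ 2 * W u) := by
        rw [lintegral_lintegral_swap hintg.aemeasurable]
    _ = (∫⁻ z, φ z) * ∫⁻ u, (∫⁻ z, φ z) * (f u ^ 2 * W u) := by
        congr 1
        refine lintegral_congr fun u => ?_
        rw [lintegral_mul_const _ (by fun_prop),
          lintegral_sub_right_eq_self φ u]
    _ = _ := by rw [lintegral_const_mul _ hfW]; ring

theorem lintegral_exp_neg_mul_Ioi {a : ℝ} (ha : 0 < a) :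
    ∫⁻ t in Ioi (0 : ℝ), ENNReal.ofReal (Real.exp (-a * t)) = (ENNReal.ofReal a)⁻¹ := by
  rw [← ofReal_integral_eq_lintegral_ofReal (integrableOn_exp_mul_Ioi (neg_lt_zero.2 ha) 0)
    (ae_of_all _ fun _ => (Real.exp_pos _).le), integral_exp_mul_Ioi (neg_lt_zero.2 ha) 0,
    ← ENNReal.ofReal_inv_of_pos ha]
  simp

/-- `L²` bound for damped free transport with constant damping rate `a`. -/
theorem lintegral_sq_damped_transport_le {a : ℝ} (ha : 0 < a) (v : E3) {g : E3 → ℝ≥0∞}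
    (hg : Measurable g) :
    ∫⁻ x, (∫⁻ t in Ioi (0 : ℝ), ENNReal.ofReal (Real.exp (-a * t)) * g (x - t • v)) ^ 2 ≤
      (ENNReal.ofReal a)⁻¹ ^ 2 * ∫⁻ x, g x ^ 2 := by
  have he : Measurable fun t : ℝ => ENNReal.ofReal (Real.exp (-a * t)) := by fun_prop
  have hintg : Measurable fun p : E3 × ℝ =>
      ENNReal.ofReal (Real.exp (-a * p.2)) * g (p.1 - p.2 • v) ^ 2 := by fun_prop
  calc ∫⁻ x, (∫⁻ t in Ioi (0 : ℝ), ENNReal.ofReal (Real.exp (-a * t)) * g (x - t • v)) ^ 2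
      ≤ ∫⁻ x, (ENNReal.ofReal a)⁻¹ *
          ∫⁻ t in Ioi (0 : ℝ), ENNReal.ofReal (Real.exp (-a * t)) * g (x - t • v) ^ 2 := by
        refine lintegral_mono fun x => ?_
        rw [← lintegral_exp_neg_mul_Ioi ha]
        exact sq_lintegral_mul_le _ he (by fun_prop)
    _ = (ENNReal.ofReal a)⁻¹ * ∫⁻ x, ∫⁻ t in Ioi (0 : ℝ),
          ENNReal.ofReal (Real.exp (-a * t)) * g (x - t • v) ^ 2 :=
        lintegral_const_mul _ hintg.lintegral_prod_right'
    _ = (ENNReal.ofReal a)⁻¹ * ∫⁻ t in Ioi (0 : ℝ), ∫⁻ x,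
          ENNReal.ofReal (Real.exp (-a * t)) * g (x - t • v) ^ 2 := by
        rw [lintegral_lintegral_swap hintg.aemeasurable]
    _ = (ENNReal.ofReal a)⁻¹ * ∫⁻ t in Ioi (0 : ℝ),
          ENNReal.ofReal (Real.exp (-a * t)) * ∫⁻ x, g x ^ 2 := by
        congr 1
        refine lintegral_congr fun t => ?_
        rw [lintegral_const_mul _ (by fun_prop),
          lintegral_sub_right_eq_self (fun x => g x ^ 2) (t • v)]
    _ = _ := by rw [lintegral_mul_const _ he, lintegral_exp_neg_mul_Ioi ha]; ring

theorem pos_and_mem_of_mem_tauItv {Ω : Set E3} {x v : E3} {t : ℝ} (ht : t ∈ tauItv Ω x v) :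
    0 < t ∧ x - t • v ∈ Ω := by
  refine ⟨ht.1, ?_⟩
  by_contra hn
  exact absurd ht.2 (not_lt.2 (sInf_le ⟨t, ⟨ht.1, hn⟩, rfl⟩))

theorem integrable_norm_rpow_mul_exp_neg_mul_sq {s b : ℝ} (hs : -3 < s) (hb : 0 < b) :
    Integrable fun z : E3 => ‖z‖ ^ s * Real.exp (-b * ‖z‖ ^ 2) := by
  refine (integrable_fun_norm_addHaar (volume : Measure E3)
    (f := fun r : ℝ => r ^ s * Real.exp (-b * r ^ 2))).2 ?_
  refine (integrableOn_rpow_mul_exp_neg_mul_sq hb (s := s + 2) (by linarith)).congr_fun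
    (fun r hr => ?_) measurableSet_Ioi
  have hr : 0 < r := hr
  simp only [finrank_euclideanSpace_fin, smul_eq_mul]
  rw [Real.rpow_add hr]
  norm_num
  ring

theorem wGamma_nonneg (γ : ℝ) {r : ℝ} (hr : 0 ≤ r) : 0 ≤ wGamma γ r := by
  unfold wGamma
  split_ifs <;> positivity

theorem measurable_wGamma (γ : ℝ) : Measurable (wGamma γ) := by
  unfold wGamma
  split_ifs
  · fun_prop
  · exact ((continuous_abs.measurable.comp Real.measurable_log).add_const 1).div measurable_id
  · fun_prop

theorem integrable_wGamma_norm_mul_exp {γ b : ℝ} (hγ : -3 < γ) (hb : 0 < b) :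
    Integrable fun z : E3 => wGamma γ ‖z‖ * Real.exp (-b * ‖z‖ ^ 2) := by
  have hm : AEStronglyMeasurable (fun z : E3 => wGamma γ ‖z‖ * Real.exp (-b * ‖z‖ ^ 2)) :=
    (((measurable_wGamma γ).comp measurable_norm).mul (by fun_prop)).aestronglyMeasurable
  have hpow : ∀ s : ℝ, -3 < s →
      Integrable fun z : E3 => ‖z‖ ^ s * Real.exp (-b * ‖z‖ ^ 2) :=
    fun s hs => integrable_norm_rpow_mul_exp_neg_mul_sq hs hb
  rcases lt_trichotomy γ (-1) with h | h | h
  · refine (hpow γ hγ).congr (ae_of_all _ fun z => ?_)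
    have : |γ| = -γ := abs_of_neg (by linarith)
    simp [wGamma, not_lt.2 h.le, h.ne, this, Real.rpow_neg (norm_nonneg z)]
  · refine (((hpow 0 (by norm_num)).add (hpow (-2) (by norm_num))).add
      (hpow (-1) (by norm_num))).mono' hm (ae_of_all _ fun z => ?_)
    rw [Real.norm_of_nonneg (mul_nonneg (wGamma_nonneg γ (norm_nonneg z)) (Real.exp_pos _).le)]
    simp only [Pi.add_apply, ← add_mul]
    gcongr
    rcases (norm_nonneg z).eq_or_lt with h0 | h0
    · rw [← h0]; simp [wGamma, h]
    · have hlog : |Real.log ‖z‖| ≤ ‖z‖ + 1 / ‖z‖ := by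
        have h1 := Real.log_le_sub_one_of_pos h0
        have h2 := Real.one_sub_inv_le_log_of_pos h0
        have h3 : 0 < 1 / ‖z‖ := by positivity
        rw [← one_div] at h2
        exact abs_le.2 ⟨by linarith, by linarith⟩
      have e2 : ‖z‖ ^ (-2 : ℝ) = 1 / ‖z‖ / ‖z‖ := by
        rw [Real.rpow_neg h0.le, Real.rpow_two]; field_simp
      rw [e2, Real.rpow_zero, Real.rpow_neg_one]
      simp only [wGamma, h, lt_irrefl, if_false, if_true]
      calc (|Real.log ‖z‖| + 1) / ‖z‖ ≤ (‖z‖ + 1 / ‖z‖ + 1) / ‖z‖ := by gcongr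
        _ = _ := by field_simp
  · refine (hpow (-1) (by norm_num)).congr (ae_of_all _ fun z => ?_)
    simp [wGamma, h, Real.rpow_neg_one]

theorem integrable_nu_integrand {γ : ℝ} (hγ : -3 < γ) (v : E3) :
    Integrable fun w : E3 => ‖v - w‖ ^ γ * Real.exp (-‖w‖ ^ 2) := by
  have h := ((integrable_norm_rpow_mul_exp_neg_mul_sq hγ (b := 1 / 2)
    (by norm_num)).comp_sub_left v).const_mul (Real.exp (‖v‖ ^ 2))
  refine h.mono' (Measurable.aestronglyMeasurable (by fun_prop)) (ae_of_all _ fun w => ?_)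
  rw [Real.norm_of_nonneg (by positivity)]
  have hn : ‖v - w‖ ≤ ‖v‖ + ‖w‖ := norm_sub_le v w
  have hexp : Real.exp (-‖w‖ ^ 2) ≤ Real.exp (‖v‖ ^ 2) * Real.exp (-(1 / 2) * ‖v - w‖ ^ 2) := by
    rw [← Real.exp_add]
    gcongr
    nlinarith [norm_nonneg (v - w), norm_nonneg v, norm_nonneg w, sq_nonneg (‖v‖ - ‖w‖)]
  calc ‖v - w‖ ^ γ * Real.exp (-‖w‖ ^ 2)
      ≤ ‖v - w‖ ^ γ * (Real.exp (‖v‖ ^ 2) * Real.exp (-(1 / 2) * ‖v - w‖ ^ 2)) := by gcongr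
    _ = _ := by ring

theorem integral_pos_of_ae_pos {g : E3 → ℝ} (hg : Integrable g) (hpos : ∀ᵐ w, 0 < g w) :
    0 < ∫ w, g w := by
  rw [integral_pos_iff_support_of_nonneg_ae (hpos.mono fun _ h => h.le) hg]
  have : Function.support g =ᵐ[volume] (univ : Set E3) :=
    Filter.eventuallyEq_univ.2 (hpos.mono fun _ h => h.ne')
  rw [measure_congr this]
  exact Measure.measure_univ_pos.2 (NeZero.ne _)

theorem exists_le_integral_of_nonpos {γ : ℝ} (hγl : -3 < γ) (hγ : γ ≤ 0) :
    ∃ c > (0 : ℝ), ∀ v : E3,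
      c * (1 + ‖v‖) ^ γ ≤ ∫ w : E3, ‖v - w‖ ^ γ * Real.exp (-‖w‖ ^ 2) := by
  have hintg : Integrable fun w : E3 => (1 + ‖w‖) ^ γ * Real.exp (-‖w‖ ^ 2) := by
    have h0 := integrable_norm_rpow_mul_exp_neg_mul_sq (s := 0) (b := 1) (by norm_num) one_pos
    refine h0.mono' (Measurable.aestronglyMeasurable (by fun_prop)) (ae_of_all _ fun w => ?_)
    rw [Real.norm_of_nonneg (by positivity), Real.rpow_zero, neg_one_mul]
    gcongr
    exact Real.rpow_le_one_of_one_le_of_nonpos (by linarith [norm_nonneg w]) hγ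
  refine ⟨_, integral_pos_of_ae_pos hintg (ae_of_all _ fun w => by positivity), fun v => ?_⟩
  rw [← integral_mul_const]
  refine integral_mono_ae (hintg.mul_const _) (integrable_nu_integrand hγl v) ?_
  filter_upwards [compl_mem_ae_iff.2 (measure_singleton v)] with w hw
  have hpos : 0 < ‖v - w‖ := norm_pos_iff.2 (sub_ne_zero.2 fun h => hw h.symm)
  have hle : ‖v - w‖ ≤ (1 + ‖w‖) * (1 + ‖v‖) := by
    nlinarith [norm_sub_le v w, norm_nonneg v, norm_nonneg w,
      mul_nonneg (norm_nonneg v) (norm_nonneg w)]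
  calc (1 + ‖w‖) ^ γ * Real.exp (-‖w‖ ^ 2) * (1 + ‖v‖) ^ γ
      = ((1 + ‖w‖) * (1 + ‖v‖)) ^ γ * Real.exp (-‖w‖ ^ 2) := by
        rw [Real.mul_rpow (by positivity) (by positivity)]; ring
    _ ≤ _ := by
        exact mul_le_mul_of_nonneg_right (Real.rpow_le_rpow_of_nonpos hpos hle hγ)
          (Real.exp_pos _).le

theorem exists_le_integral_of_nonneg {γ : ℝ} (hγ : 0 ≤ γ) (hγu : γ ≤ 1) :
    ∃ c > (0 : ℝ), ∀ v : E3,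
      c * (1 + ‖v‖) ^ γ ≤ ∫ w : E3, ‖v - w‖ ^ γ * Real.exp (-‖w‖ ^ 2) := by
  have hintg : Integrable fun w : E3 => min 1 ‖w‖ ^ γ * Real.exp (-‖w‖ ^ 2) := by
    have h0 := integrable_norm_rpow_mul_exp_neg_mul_sq (s := 0) (b := 1) (by norm_num) one_pos
    refine h0.mono' (Measurable.aestronglyMeasurable (by fun_prop)) (ae_of_all _ fun w => ?_)
    rw [Real.norm_of_nonneg (by positivity), Real.rpow_zero, neg_one_mul]
    gcongr
    exact Real.rpow_le_one (by positivity) (min_le_left _ _) hγ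
  have hpos : 0 < ∫ w : E3, min 1 ‖w‖ ^ γ * Real.exp (-‖w‖ ^ 2) := by
    refine integral_pos_of_ae_pos hintg ?_
    filter_upwards [compl_mem_ae_iff.2 (measure_singleton (0 : E3))] with w hw
    have : 0 < ‖w‖ := norm_pos_iff.2 hw
    positivity
  refine ⟨_, half_pos hpos, fun v => ?_⟩
  have hI := integrable_nu_integrand (by linarith : -3 < γ) v
  have hrefl : ∫ w : E3, ‖v + w‖ ^ γ * Real.exp (-‖w‖ ^ 2) =
      ∫ w : E3, ‖v - w‖ ^ γ * Real.exp (-‖w‖ ^ 2) := by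
    rw [← integral_neg_eq_self]
    simp [sub_eq_add_neg]
  have hI' : Integrable fun w : E3 => ‖v + w‖ ^ γ * Real.exp (-‖w‖ ^ 2) := by
    simpa [sub_neg_eq_add] using hI.comp_neg
  have hsum : (∫ w : E3, min 1 ‖w‖ ^ γ * Real.exp (-‖w‖ ^ 2)) * (1 + ‖v‖) ^ γ ≤
      ∫ w : E3, (‖v - w‖ ^ γ * Real.exp (-‖w‖ ^ 2) + ‖v + w‖ ^ γ * Real.exp (-‖w‖ ^ 2)) := by
    rw [← integral_mul_const]
    refine integral_mono (hintg.mul_const _) (hI.add hI') fun w => ?_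
    have hle : min 1 ‖w‖ * (1 + ‖v‖) ≤ ‖v - w‖ + ‖v + w‖ := by
      have h1 : min 1 ‖w‖ * (1 + ‖v‖) ≤ ‖w‖ + ‖v‖ := by
        nlinarith [min_le_left 1 ‖w‖, min_le_right 1 ‖w‖, norm_nonneg v]
      have h2 : ‖(2 : ℝ) • v‖ ≤ ‖v - w‖ + ‖v + w‖ := by
        have : (2 : ℝ) • v = (v - w) + (v + w) := by rw [two_smul]; abel
        rw [this]; exact norm_add_le _ _
      have h3 : ‖(2 : ℝ) • w‖ ≤ ‖v - w‖ + ‖v + w‖ := by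
        have : (2 : ℝ) • w = (v + w) - (v - w) := by rw [two_smul]; abel
        rw [this]; exact (norm_sub_le (v + w) (v - w)).trans_eq (add_comm _ _)
      rw [norm_smul, Real.norm_two] at h2 h3
      linarith
    calc min 1 ‖w‖ ^ γ * Real.exp (-‖w‖ ^ 2) * (1 + ‖v‖) ^ γ
        = (min 1 ‖w‖ * (1 + ‖v‖)) ^ γ * Real.exp (-‖w‖ ^ 2) := by
          rw [Real.mul_rpow (by positivity) (by positivity)]; ring
      _ ≤ (‖v - w‖ ^ γ + ‖v + w‖ ^ γ) * Real.exp (-‖w‖ ^ 2) := by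
          gcongr
          exact (Real.rpow_le_rpow (by positivity) hle hγ).trans
            (Real.rpow_add_le_add_rpow (norm_nonneg _) (norm_nonneg _) hγ hγu)
      _ = _ := add_mul _ _ _
  rw [integral_add hI hI', hrefl] at hsum
  linarith

/-- Coercivity of the collision frequency. -/
theorem exists_mul_rpow_le_nu {γ B₀ : ℝ} (hγl : -3 < γ) (hγu : γ ≤ 1) (hB₀ : 0 < B₀) :
    ∃ c > (0 : ℝ), ∀ v : E3, c * (1 + ‖v‖) ^ γ ≤ nu B₀ γ v := by
  obtain ⟨c, hc, h⟩ : ∃ c > (0 : ℝ), ∀ v : E3,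
      c * (1 + ‖v‖) ^ γ ≤ ∫ w : E3, ‖v - w‖ ^ γ * Real.exp (-‖w‖ ^ 2) := by
    rcases le_total γ 0 with h0 | h0
    · exact exists_le_integral_of_nonpos hγl h0
    · exact exists_le_integral_of_nonneg h0 hγu
  refine ⟨B₀ * π * c, by positivity, fun v => ?_⟩
  rw [mul_assoc]
  exact mul_le_mul_of_nonneg_left (h v) (by positivity)

/-- The velocity-dependent version of `lintegral_sq_damped_transport_le`, with damping rate at
least `c * W v` and transport stopped when the trajectory leaves `Ω`. -/
theorem lintegral_sq_stopped_transport_le {Ω : Set E3} (hΩ : MeasurableSet Ω) {c : ℝ} (hc : 0 < c)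
    {W ν : E3 → ℝ} (hW : Measurable W) (hWpos : ∀ v, 0 < W v) (hν : ∀ v, c * W v ≤ ν v)
    {G : E3 → E3 → ℝ≥0∞} (hG : Measurable (Function.uncurry G)) :
    (∫⁻ x in Ω, ∫⁻ v, (∫⁻ t in tauItv Ω x v,
        ENNReal.ofReal (Real.exp (-(ν v) * t)) * G (x - t • v) v) ^ 2 * ENNReal.ofReal (W v)) ≤
      (ENNReal.ofReal c)⁻¹ ^ 2 *
        ∫⁻ x in Ω, ∫⁻ v, G x v ^ 2 * (ENNReal.ofReal (W v))⁻¹ := by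
  set F : E3 → E3 → ℝ≥0∞ := fun x v => Ω.indicator (fun y => G y v) x with hF
  have hFm : Measurable (Function.uncurry F) := by
    have : Function.uncurry F = (Prod.fst ⁻¹' Ω).indicator (Function.uncurry G) := by
      ext p; rfl
    rw [this]
    exact hG.indicator (measurable_fst hΩ)
  have hFm' : Measurable fun p : E3 × E3 => F p.1 p.2 := hFm
  have hker : Measurable fun q : (E3 × E3) × ℝ =>
      ENNReal.ofReal (Real.exp (-(c * W q.1.2) * q.2)) * F (q.1.1 - q.2 • q.1.2) q.1.2 :=
    Measurable.mul (by fun_prop) (hFm'.comp (by fun_prop :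
      Measurable fun q : (E3 × E3) × ℝ => (q.1.1 - q.2 • q.1.2, q.1.2)))
  have hI : Measurable fun p : E3 × E3 => (∫⁻ t in Ioi (0 : ℝ),
      ENNReal.ofReal (Real.exp (-(c * W p.2) * t)) * F (p.1 - t • p.2) p.2) ^ 2 *
        ENNReal.ofReal (W p.2) :=
    (hker.lintegral_prod_right'.pow_const 2).mul (by fun_prop)
  have hpt : ∀ x v, ∫⁻ t in tauItv Ω x v,
      ENNReal.ofReal (Real.exp (-(ν v) * t)) * G (x - t • v) v ≤
      ∫⁻ t in Ioi (0 : ℝ), ENNReal.ofReal (Real.exp (-(c * W v) * t)) * F (x - t • v) v := by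
    intro x v
    refine (setLIntegral_mono (hker.comp (measurable_prodMk_left (x := (x, v))))
      fun t ht => ?_).trans (lintegral_mono_set fun t ht => ht.1)
    obtain ⟨ht0, htΩ⟩ := pos_and_mem_of_mem_tauItv ht
    simp only [Function.comp_apply, hF, indicator_of_mem htΩ]
    gcongr
    exact hν v
  have hconst : ∀ v, (ENNReal.ofReal (c * W v))⁻¹ ^ 2 * ENNReal.ofReal (W v) =
      (ENNReal.ofReal c)⁻¹ ^ 2 * (ENNReal.ofReal (W v))⁻¹ := fun v => by
    have h0 : ENNReal.ofReal (W v) ≠ 0 := by simpa using hWpos v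
    rw [ENNReal.ofReal_mul hc.le, ENNReal.mul_inv (Or.inr ENNReal.ofReal_ne_top) (Or.inr h0),
      mul_pow, sq (ENNReal.ofReal (W v))⁻¹, mul_assoc, mul_assoc,
      ENNReal.inv_mul_cancel h0 ENNReal.ofReal_ne_top, mul_one]
  have hFW : Measurable fun p : E3 × E3 => F p.2 p.1 ^ 2 * (ENNReal.ofReal (W p.1))⁻¹ :=
    ((hFm'.comp measurable_swap).pow_const 2).mul (by fun_prop)
  calc _ ≤ ∫⁻ x in Ω, ∫⁻ v, (∫⁻ t in Ioi (0 : ℝ),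
          ENNReal.ofReal (Real.exp (-(c * W v) * t)) * F (x - t • v) v) ^ 2 *
            ENNReal.ofReal (W v) := by
        refine lintegral_mono fun x => lintegral_mono fun v => ?_
        exact mul_le_mul_left (pow_le_pow_left' (hpt x v) 2) _
    _ ≤ ∫⁻ x, ∫⁻ v, (∫⁻ t in Ioi (0 : ℝ),
          ENNReal.ofReal (Real.exp (-(c * W v) * t)) * F (x - t • v) v) ^ 2 *
            ENNReal.ofReal (W v) := setLIntegral_le_lintegral _ _
    _ = ∫⁻ v, ∫⁻ x, (∫⁻ t in Ioi (0 : ℝ),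
          ENNReal.ofReal (Real.exp (-(c * W v) * t)) * F (x - t • v) v) ^ 2 *
            ENNReal.ofReal (W v) := lintegral_lintegral_swap hI.aemeasurable
    _ ≤ ∫⁻ v, (ENNReal.ofReal c)⁻¹ ^ 2 * ∫⁻ x, F x v ^ 2 * (ENNReal.ofReal (W v))⁻¹ := by
        refine lintegral_mono fun v => ?_
        have hFv : Measurable fun x => F x v := hFm'.comp measurable_prodMk_right
        rw [lintegral_mul_const' _ _ ENNReal.ofReal_ne_top,
          lintegral_mul_const _ (hFv.pow_const 2)]
        calc _ ≤ ((ENNReal.ofReal (c * W v))⁻¹ ^ 2 * ∫⁻ x, F x v ^ 2) *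
              ENNReal.ofReal (W v) := by
              gcongr
              exact lintegral_sq_damped_transport_le (mul_pos hc (hWpos v)) v hFv
          _ = ((ENNReal.ofReal (c * W v))⁻¹ ^ 2 * ENNReal.ofReal (W v)) *
              ∫⁻ x, F x v ^ 2 := by ring
          _ = _ := by rw [hconst]; ring
    _ = (ENNReal.ofReal c)⁻¹ ^ 2 * ∫⁻ v, ∫⁻ x, F x v ^ 2 * (ENNReal.ofReal (W v))⁻¹ :=
        lintegral_const_mul _ hFW.lintegral_prod_right'
    _ = (ENNReal.ofReal c)⁻¹ ^ 2 * ∫⁻ x, ∫⁻ v, F x v ^ 2 * (ENNReal.ofReal (W v))⁻¹ := by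
        rw [lintegral_lintegral_swap hFW.aemeasurable]
    _ = _ := by
        rw [← lintegral_indicator hΩ]
        congr 1
        refine lintegral_congr fun x => ?_
        by_cases hx : x ∈ Ω <;> simp [hF, hx]

/-- Boundedness of `S_Ω K_α` on the weighted space `L²_{0,γ/2}(Ω × ℝ³)`. -/
theorem SOmega_Kalpha_L2_bounded (Ω : Set E3) (hΩo : IsOpen Ω) (hΩb : Bornology.IsBounded Ω)
    (hΩc : Convex ℝ Ω) (γ B₀ C₀ α₁ α₂ α₃ : ℝ) (hγl : -3 < γ) (hγu : γ ≤ 1) (hB₀ : 0 < B₀)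
    (hC₀ : 0 < C₀) (hα₁ : 0 < α₁) (hα₂ : 0 < α₂) (hα₃ : 0 < α₃)
    (kα : E3 → E3 → ℝ) (hmeas : Measurable (Function.uncurry kα))
    (hb1 : ∀ v vs : E3, v ≠ vs →
      |kα v vs| ≤ C₀ * wGamma γ ‖v - vs‖ * (1 + ‖v‖ + ‖vs‖) ^ (γ - 1) *
        Real.exp (-α₁ * ‖v - vs‖ ^ 2) *
        Real.exp (-α₃ * (⟪v - vs, v⟫ / ‖v - vs‖ - α₂ * ‖v - vs‖) ^ 2))
    (hb2 : ∀ v vs : E3, v ≠ vs →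
      |kα v vs| ≤ C₀ * wGamma γ ‖v - vs‖ * (1 + ‖v‖ + ‖vs‖) ^ (γ - 1) *
        Real.exp (-α₁ * ‖v - vs‖ ^ 2) *
        Real.exp (-α₃ * (⟪v - vs, vs⟫ / ‖v - vs‖ + α₂ * ‖v - vs‖) ^ 2)) :
    ∃ C > (0 : ℝ), ∀ h : E3 → E3 → ℝ, Measurable (Function.uncurry h) →
      (∫⁻ x in Ω, ∫⁻ v : E3,
          (∫⁻ t in tauItv Ω x v, ENNReal.ofReal (Real.exp (-(nu B₀ γ v) * t)) *
            ∫⁻ vs : E3, ENNReal.ofReal (|kα v vs| * |h (x - t • v) vs|)) ^ 2 *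
          ENNReal.ofReal ((1 + ‖v‖) ^ γ)) ≤
        ENNReal.ofReal C * ∫⁻ x in Ω, ∫⁻ v : E3,
          ENNReal.ofReal (h x v ^ 2 * (1 + ‖v‖) ^ γ) := by
  obtain ⟨c, hc, hnu⟩ := exists_mul_rpow_le_nu hγl hγu hB₀
  set φ : E3 → ℝ := fun z => C₀ * (wGamma γ ‖z‖ * Real.exp (-α₁ * ‖z‖ ^ 2)) with hφ
  have hφi : Integrable φ := (integrable_wGamma_norm_mul_exp hγl hα₁).const_mul C₀
  have hφ0 : ∀ z, 0 ≤ φ z := fun z =>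
    mul_nonneg hC₀.le (mul_nonneg (wGamma_nonneg γ (norm_nonneg z)) (Real.exp_pos _).le)
  have hφm : Measurable φ :=
    (((measurable_wGamma γ).comp measurable_norm).mul (by fun_prop)).const_mul C₀
  set W : E3 → ℝ := fun v => (1 + ‖v‖) ^ γ with hW
  have hWm : Measurable W := by fun_prop
  have hWpos : ∀ v, 0 < W v := fun v => by positivity
  have hk : ∀ v u : E3, v ≠ u → |kα v u| ≤ φ (v - u) * (1 + ‖v‖ + ‖u‖) ^ (γ - 1) := by
    intro v u huv
    have hexp : Real.exp (-α₃ * (⟪v - u, v⟫ / ‖v - u‖ - α₂ * ‖v - u‖) ^ 2) ≤ 1 :=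
      Real.exp_le_one_iff.2 (by nlinarith [sq_nonneg (⟪v - u, v⟫ / ‖v - u‖ - α₂ * ‖v - u‖)])
    refine (hb1 v u huv).trans ((mul_le_of_le_one_right ?_ hexp).trans_eq ?_)
    · have := wGamma_nonneg γ (norm_nonneg (v - u))
      positivity
    · simp only [hφ]; ring
  have hdec : ∀ a b : ℝ, 0 ≤ a → 1 + a ≤ b → b ^ (γ - 1) ≤ (1 + a) ^ γ := fun a b ha hab =>
    (Real.rpow_le_rpow_of_nonpos (by linarith) hab (by linarith)).trans
      (Real.rpow_le_rpow_of_exponent_le (by linarith) (by linarith))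
  have hk₁ : ∀ v u : E3, v ≠ u → ENNReal.ofReal |kα v u| ≤
      ENNReal.ofReal (φ (v - u)) * ENNReal.ofReal (W v) := fun v u huv => by
    rw [← ENNReal.ofReal_mul (hφ0 _)]
    exact ENNReal.ofReal_le_ofReal ((hk v u huv).trans (mul_le_mul_of_nonneg_left
      (hdec _ _ (norm_nonneg v) (by linarith [norm_nonneg u])) (hφ0 _)))
  have hk₂ : ∀ v u : E3, v ≠ u → ENNReal.ofReal |kα v u| ≤
      ENNReal.ofReal (φ (v - u)) * ENNReal.ofReal (W u) := fun v u huv => by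
    rw [← ENNReal.ofReal_mul (hφ0 _)]
    exact ENNReal.ofReal_le_ofReal ((hk v u huv).trans (mul_le_mul_of_nonneg_left
      (hdec _ _ (norm_nonneg u) (by linarith [norm_nonneg v])) (hφ0 _)))
  have hM : ∫⁻ z, ENNReal.ofReal (φ z) = ENNReal.ofReal (∫ z, φ z) :=
    (ofReal_integral_eq_lintegral_ofReal hφi (ae_of_all _ hφ0)).symm
  have hM0 : 0 ≤ ∫ z, φ z := integral_nonneg hφ0
  refine ⟨c⁻¹ ^ 2 * (∫ z, φ z) ^ 2 + 1, by positivity, fun h hh => ?_⟩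
  have hkm : Measurable fun p : E3 × E3 => kα p.1 p.2 := hmeas
  have hhm : Measurable fun p : E3 × E3 => h p.1 p.2 := hh
  have hG : Measurable (Function.uncurry fun y v : E3 =>
      ∫⁻ u, ENNReal.ofReal (|kα v u| * |h y u|)) := by
    have : Measurable fun q : (E3 × E3) × E3 =>
        ENNReal.ofReal (|kα q.1.2 q.2| * |h q.1.1 q.2|) := by
      have h1 : Measurable fun q : (E3 × E3) × E3 => kα q.1.2 q.2 :=
        hkm.comp (by fun_prop : Measurable fun q : (E3 × E3) × E3 => (q.1.2, q.2))
      have h2 : Measurable fun q : (E3 × E3) × E3 => h q.1.1 q.2 :=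
        hhm.comp (by fun_prop : Measurable fun q : (E3 × E3) × E3 => (q.1.1, q.2))
      exact ((continuous_abs.measurable.comp h1).mul
        (continuous_abs.measurable.comp h2)).ennreal_ofReal
    exact this.lintegral_prod_right'
  have hkabs : Measurable (Function.uncurry fun v u : E3 => ENNReal.ofReal |kα v u|) :=
    (continuous_abs.measurable.comp hkm).ennreal_ofReal
  have hschur : ∀ y : E3, ∫⁻ v, (∫⁻ u, ENNReal.ofReal (|kα v u| * |h y u|)) ^ 2 *
      (ENNReal.ofReal (W v))⁻¹ ≤ ENNReal.ofReal (∫ z, φ z) ^ 2 *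
        ∫⁻ v, ENNReal.ofReal (h y v ^ 2 * (1 + ‖v‖) ^ γ) := by
    intro y
    have hy : Measurable fun u => h y u := hhm.comp measurable_prodMk_left
    have := lintegral_sq_kernel_le hkabs hφm.ennreal_ofReal hWm.ennreal_ofReal
      (continuous_abs.measurable.comp hy).ennreal_ofReal
      (fun v => by simpa using hWpos v) (fun v => ENNReal.ofReal_ne_top) hk₁ hk₂
    rw [hM] at this
    simpa only [Function.comp_apply, ENNReal.ofReal_mul (abs_nonneg _),
      ENNReal.ofReal_mul (sq_nonneg _), ← ENNReal.ofReal_pow (abs_nonneg _), sq_abs] using this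
  calc _ ≤ (ENNReal.ofReal c)⁻¹ ^ 2 * ∫⁻ x in Ω, ∫⁻ v,
        (∫⁻ u, ENNReal.ofReal (|kα v u| * |h x u|)) ^ 2 * (ENNReal.ofReal (W v))⁻¹ :=
        lintegral_sq_stopped_transport_le hΩo.measurableSet hc hWm hWpos hnu hG
    _ ≤ (ENNReal.ofReal c)⁻¹ ^ 2 * ∫⁻ x in Ω, ENNReal.ofReal (∫ z, φ z) ^ 2 *
          ∫⁻ v, ENNReal.ofReal (h x v ^ 2 * (1 + ‖v‖) ^ γ) := by
        gcongr with x
        exact hschur x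
    _ = ENNReal.ofReal (c⁻¹ ^ 2 * (∫ z, φ z) ^ 2) *
          ∫⁻ x in Ω, ∫⁻ v, ENNReal.ofReal (h x v ^ 2 * (1 + ‖v‖) ^ γ) := by
        rw [lintegral_const_mul' _ _ (ENNReal.pow_ne_top ENNReal.ofReal_ne_top), ← mul_assoc,
          ENNReal.ofReal_mul (by positivity), ENNReal.ofReal_pow (by positivity),
          ENNReal.ofReal_pow hM0, ENNReal.ofReal_inv_of_pos hc]
    _ ≤ _ := by
        gcongr
        linarith
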